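/- arXiv:1706.09231 — 5 statements merged into one kernel-verified Lean document; each statement's English description precedes it below -/
import Mathlib

section
/- Let N₁,…,N_k be finitely many norms on ℝ^p, let C := convexHull(⋃_{i=1}^k {β ∈ ℝ^p : N_i(β) ≤ 1}), and let g be the gauge of C, g(x) := inf{λ > 0 : x ∈ λ·C}. Then the dual norm of g equals the pointwise maximum of the dual norms: g*(z) = max_{1 ≤ i ≤ k} N_i*(z) for every z ∈ ℝ^p. -/
open Finset

/-- A norm on `ℝ^p`: positive definite, absolutely homogeneous and subadditive. -/
def IsNorm {p : ℕ} (N : (Fin p → ℝ) → ℝ) : Prop :=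
  (∀ β, N β = 0 → β = 0) ∧ (∀ (c : ℝ) (β), N (c • β) = |c| * N β) ∧
    (∀ β γ, N (β + γ) ≤ N β + N γ)

/-- The dual norm `N*(z) = sup {βᵀz : N(β) ≤ 1}`. -/
noncomputable def dualNorm {p : ℕ} (N : (Fin p → ℝ) → ℝ) (z : Fin p → ℝ) : ℝ :=
  sSup ((fun β => ∑ i, β i * z i) '' {β | N β ≤ 1})

/-- On a finite-dimensional real space, any linear functional is bounded by a multiple of any
definite seminorm. -/
theorem LinearMap.exists_le_mul_seminorm {E : Type*} [AddCommGroup E] [Module ℝ E]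
    [FiniteDimensional ℝ E] (N : Seminorm ℝ E) (hN : ∀ x, N x = 0 → x = 0) (f : E →ₗ[ℝ] ℝ) :
    ∃ c, 0 ≤ c ∧ ∀ x, f x ≤ c * N x := by
  let _ : NormedAddCommGroup E := AddGroupNorm.toNormedAddCommGroup
    { toFun := N
      map_zero' := map_zero N
      add_le' := map_add_le_add N
      neg' := map_neg_eq_map N
      eq_zero_of_map_eq_zero' := hN }
  let _ : NormedSpace ℝ E := ⟨fun a b => (map_smul_eq_mul N a b).le⟩
  refine ⟨‖LinearMap.toContinuousLinearMap f‖, norm_nonneg _, fun x => ?_⟩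
  exact (le_abs_self _).trans ((LinearMap.toContinuousLinearMap f).le_opNorm x)

/-- A nonnegative bound of a linear functional on an absorbent set extends to the unit ball of
the gauge. -/
theorem LinearMap.le_of_gauge_le_one {E : Type*} [AddCommGroup E] [Module ℝ E] {s : Set E}
    (hs : Absorbent ℝ s) (f : E →ₗ[ℝ] ℝ) {M : ℝ} (hM : 0 ≤ M) (hf : ∀ x ∈ s, f x ≤ M) {x : E}
    (hx : gauge s x ≤ 1) : f x ≤ M := by
  refine le_of_forall_pos_le_add fun ε hε => ?_
  have hpos : 0 < ε / (M + 1) := by positivity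
  obtain ⟨r, hr, hr', y, hy, rfl⟩ := exists_lt_of_gauge_lt hs
    (show gauge s x < 1 + ε / (M + 1) by linarith)
  have hεM : M * (ε / (M + 1)) ≤ ε := by
    rw [mul_div_assoc', div_le_iff₀ (by positivity)]
    nlinarith
  calc f (r • y) = r * f y := by simp
    _ ≤ r * M := by gcongr; exact hf y hy
    _ ≤ (1 + ε / (M + 1)) * M := by gcongr
    _ ≤ M + ε := by linarith

/-- A function satisfying `IsNorm`, as a bundled seminorm. -/
noncomputable def IsNorm.toSeminorm {p : ℕ} {N : (Fin p → ℝ) → ℝ} (h : IsNorm N) :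
    Seminorm ℝ (Fin p → ℝ) :=
  Seminorm.of N h.2.2 h.2.1

theorem IsNorm.bddAbove {p : ℕ} {N : (Fin p → ℝ) → ℝ} (h : IsNorm N) (z : Fin p → ℝ) :
    BddAbove ((fun β => ∑ i, β i * z i) '' {β | N β ≤ 1}) := by
  obtain ⟨c, hc, hf⟩ := LinearMap.exists_le_mul_seminorm h.toSeminorm h.1
    ((dotProductBilin ℝ ℝ).flip z)
  refine ⟨c, ?_⟩
  rintro _ ⟨β, hβ, rfl⟩
  exact (hf β).trans (mul_le_of_le_one_right hc hβ)

theorem IsNorm.le_dualNorm {p : ℕ} {N : (Fin p → ℝ) → ℝ} (h : IsNorm N) (z : Fin p → ℝ)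
    {β : Fin p → ℝ} (hβ : N β ≤ 1) : ∑ i, β i * z i ≤ dualNorm N z :=
  le_csSup (h.bddAbove z) ⟨β, hβ, rfl⟩

theorem IsNorm.map_zero {p : ℕ} {N : (Fin p → ℝ) → ℝ} (h : IsNorm N) : N 0 = 0 := by
  simpa using h.2.1 0 0

theorem IsNorm.dualNorm_nonneg {p : ℕ} {N : (Fin p → ℝ) → ℝ} (h : IsNorm N) (z : Fin p → ℝ) :
    0 ≤ dualNorm N z := by
  simpa using h.le_dualNorm z (β := 0) (by simp [h.map_zero])

theorem IsNorm.absorbent_unitBall {p : ℕ} {N : (Fin p → ℝ) → ℝ} (h : IsNorm N) :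
    Absorbent ℝ {β | N β ≤ 1} := by
  have := h.toSeminorm.absorbent_closedBall_zero one_pos
  rwa [Seminorm.closedBall_zero_eq] at this

/-- The dual norm of the gauge of the convex hull of the union of the unit balls of
finitely many norms `N₁,…,N_k` equals the pointwise maximum of the dual norms. -/
theorem stmt4 {p k : ℕ} (N : Fin (k + 1) → ((Fin p → ℝ) → ℝ)) (hN : ∀ i, IsNorm (N i))
    (C : Set (Fin p → ℝ)) (hC : C = convexHull ℝ (⋃ i, {β | N i β ≤ 1})) :
    ∀ z : Fin p → ℝ,
      dualNorm (gauge C) z =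
        Finset.univ.sup' Finset.univ_nonempty (fun i : Fin (k + 1) => dualNorm (N i) z) := by
  intro z
  subst hC
  set C := convexHull ℝ (⋃ i, {β | N i β ≤ 1})
  set M := Finset.univ.sup' Finset.univ_nonempty (fun i : Fin (k + 1) => dualNorm (N i) z)
  let f : (Fin p → ℝ) →ₗ[ℝ] ℝ := (dotProductBilin ℝ ℝ).flip z
  have hball : ∀ i, {β | N i β ≤ 1} ⊆ C := fun i =>
    (Set.subset_iUnion (fun i => {β | N i β ≤ 1}) i).trans (subset_convexHull ℝ _)
  have hle : ∀ i, dualNorm (N i) z ≤ M := fun i =>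
    Finset.le_sup' (fun i => dualNorm (N i) z) (Finset.mem_univ i)
  have hC : ∀ β ∈ C, f β ≤ M := convexHull_min
    (Set.iUnion_subset fun i β hβ => ((hN i).le_dualNorm z hβ).trans (hle i))
    (convex_halfSpace_le f.isLinear M)
  have hM : 0 ≤ M := ((hN 0).dualNorm_nonneg z).trans (hle 0)
  have hub : M ∈ upperBounds ((fun β => ∑ i, β i * z i) '' {β | gauge C β ≤ 1}) := by
    rintro _ ⟨β, hβ, rfl⟩
    exact f.le_of_gauge_le_one ((hN 0).absorbent_unitBall.mono (hball 0)) hM hC hβ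
  apply le_antisymm
  · exact csSup_le ⟨_, 0, by simp, rfl⟩ hub
  · refine Finset.sup'_le _ _ fun i _ => csSup_le_csSup ⟨M, hub⟩ ⟨_, 0, ?_, rfl⟩
      (Set.image_mono fun β hβ => gauge_le_one_of_mem (hball i hβ))
    simp [(hN i).map_zero]
end

section
/- (Deterministic part of Theorem 2.) Consider the linear model Y = Xβ⁰ + ε with X an n×p real matrix, β⁰, β̂ ∈ ℝ^p, ε ∈ ℝⁿ, and λ_J > 0. Fix J ⊆ {1,…,p} and Ĉ ∈ ℝ^{|J^c|×|J|}; set X̃ := X_J − X_{J^c}Ĉ, Σ̂_J := X̃ᵀX̃/n (assumed positive definite, with positive-definite inverse square root Σ̂_J^{−1/2}), T_J := X̃ᵀX_J/n (assumed invertible), M := √n·Σ̂_J^{−1/2}T_J, and b̂_J := β̂_J + T_J^{−1}X̃ᵀ(Y − Xβ̂)/n ∈ ℝ^{|J|}. Let Ω be a norm on ℝ^p and define Ξ(A) := Σ_{j∈J} Ω(A_j) for |J^c|×|J| matrices A (columns extended by zero to ℝ^p on the coordinates J), with dual matrix norm Ξ*. Assume Ξ*( X_{J^c}ᵀ X̃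 Σ̂_J^{−1/2}/n ) ≤ λ_J. Then M(b̂_J − β⁰_J) = Σ̂_J^{−1/2}X̃ᵀε/√n + rem, where rem := Σ̂_J^{−1/2}X̃ᵀX_{J^c}(β⁰ − β̂)_{J^c}/√n satisfies ‖rem‖_∞ ≤ √n·λ_J·Ω((β̂ − β⁰)_{J^c}); if moreover Ω is weakly decomposable for J, then ‖rem‖_∞ ≤ 2√n·λ_J·Ω(β̂ − β⁰). -/
open Finset Matrix

/-- `Ω` is weakly decomposable for `S`: there is a norm `Ω'` on the subspace of vectors
supported in `Sᶜ` such that `Ω(β_S) + Ω'(β_{Sᶜ}) ≤ Ω(β)` for all `β`. -/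
def WeaklyDecomposable {p : ℕ} (Ω : (Fin p → ℝ) → ℝ) (S : Finset (Fin p)) : Prop :=
  ∃ Ω' : (Fin p → ℝ) → ℝ,
    (∀ β : Fin p → ℝ, (∀ i ∈ S, β i = 0) → Ω' β = 0 → β = 0) ∧
    (∀ (c : ℝ) (β : Fin p → ℝ), (∀ i ∈ S, β i = 0) → Ω' (c • β) = |c| * Ω' β) ∧
    (∀ β γ : Fin p → ℝ, (∀ i ∈ S, β i = 0) → (∀ i ∈ S, γ i = 0) →
      Ω' (β + γ) ≤ Ω' β + Ω' γ) ∧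
    (∀ β : Fin p → ℝ,
      Ω (fun i => if i ∈ S then β i else 0) + Ω' (fun i => if i ∈ S then 0 else β i) ≤ Ω β)

section AbstractNorm

variable {E : Type*} [AddCommGroup E] [Module ℝ E] {N : E → ℝ}

lemma norm_zero_of_smul (hs : ∀ (c : ℝ) (x), N (c • x) = |c| * N x) : N 0 = 0 := by
  simpa using hs 0 0

lemma norm_neg_of_smul (hs : ∀ (c : ℝ) (x), N (c • x) = |c| * N x) (x : E) : N (-x) = N x := by
  simpa using hs (-1) x

lemma norm_nonneg_of_smul_of_add (hs : ∀ (c : ℝ) (x), N (c • x) = |c| * N x)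
    (ha : ∀ x y, N (x + y) ≤ N x + N y) (x : E) : 0 ≤ N x := by
  have h := ha x (-x)
  rw [add_neg_cancel, norm_zero_of_smul hs, norm_neg_of_smul hs] at h
  linarith

/-- A linear functional on a finite-dimensional space is bounded by any norm. -/
lemma exists_linear_le_mul_norm [FiniteDimensional ℝ E] (h0 : ∀ x, N x = 0 → x = 0)
    (hs : ∀ (c : ℝ) (x), N (c • x) = |c| * N x)
    (ha : ∀ x y, N (x + y) ≤ N x + N y) (f : E →ₗ[ℝ] ℝ) :
    ∃ C, 0 ≤ C ∧ ∀ x, f x ≤ C * N x := by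
  let G : AddGroupNorm E :=
    { toFun := N
      map_zero' := norm_zero_of_smul hs
      add_le' := ha
      neg' := norm_neg_of_smul hs
      eq_zero_of_map_eq_zero' := h0 }
  let _ : NormedAddCommGroup E := G.toNormedAddCommGroup
  let _ : NormedSpace ℝ E := ⟨fun c x => (hs c x).le⟩
  let g : E →L[ℝ] ℝ := LinearMap.toContinuousLinearMap f
  exact ⟨‖g‖, norm_nonneg _, fun x => (le_abs_self _).trans (g.le_opNorm x)⟩

/-- The dual norm inequality `f x ≤ N*(f) N(x)` for a norm on a finite-dimensional space. -/
lemma linear_le_sSup_mul_norm [FiniteDimensional ℝ E] (h0 : ∀ x, N x = 0 → x = 0)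
    (hs : ∀ (c : ℝ) (x), N (c • x) = |c| * N x)
    (ha : ∀ x y, N (x + y) ≤ N x + N y) (f : E →ₗ[ℝ] ℝ) (x : E) :
    f x ≤ sSup (f '' {y | N y ≤ 1}) * N x := by
  obtain ⟨C, hC, hf⟩ := exists_linear_le_mul_norm h0 hs ha f
  have hbdd : BddAbove (f '' {y | N y ≤ 1}) := by
    refine ⟨C, ?_⟩
    rintro _ ⟨y, hy, rfl⟩
    exact (hf y).trans (mul_le_of_le_one_right hC hy)
  rcases (norm_nonneg_of_smul_of_add hs ha x).eq_or_lt with hx | hx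
  · rw [h0 x hx.symm, norm_zero_of_smul hs]
    simp
  · have hmem : f ((N x)⁻¹ • x) ∈ f '' {y | N y ≤ 1} := by
      refine ⟨_, ?_, rfl⟩
      change N ((N x)⁻¹ • x) ≤ 1
      rw [hs, abs_of_pos (inv_pos.2 hx), inv_mul_cancel₀ hx.ne']
    have h := le_csSup hbdd hmem
    rw [map_smul, smul_eq_mul, inv_mul_le_iff₀ hx] at h
    linarith

end AbstractNorm

section Extension

variable {p : ℕ} {κ : Type*} [Fintype κ]

/-- The `j`-th column of `A`, extended by zero outside `S`. -/
def extendCol {S : Finset (Fin p)} (A : Matrix {i // i ∈ S} κ ℝ) (j : κ) : Fin p → ℝ :=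
  fun i => if h : i ∈ S then A ⟨i, h⟩ j else 0

/-- The sum over the columns of `A` of the norms of their extensions by zero. -/
def colNorm (Om : (Fin p → ℝ) → ℝ) {S : Finset (Fin p)} (A : Matrix {i // i ∈ S} κ ℝ) : ℝ :=
  ∑ j, Om (extendCol A j)

variable {Om : (Fin p → ℝ) → ℝ} {S : Finset (Fin p)}

lemma colNorm_eq_zero (hOm : IsNorm Om) (A : Matrix {i // i ∈ S} κ ℝ)
    (hA : colNorm Om A = 0) : A = 0 := by
  have h := (Finset.sum_eq_zero_iff_of_nonneg
    (fun j _ => norm_nonneg_of_smul_of_add hOm.2.1 hOm.2.2 (extendCol A j))).1 hA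
  ext i j
  have h' := congrFun (hOm.1 _ (h j (Finset.mem_univ j))) i.1
  simpa [extendCol] using h'

lemma colNorm_smul (hOm : IsNorm Om) (c : ℝ) (A : Matrix {i // i ∈ S} κ ℝ) :
    colNorm Om (c • A) = |c| * colNorm Om A := by
  rw [colNorm, colNorm, Finset.mul_sum]
  refine Finset.sum_congr rfl fun j _ => ?_
  rw [← hOm.2.1]
  congr 1
  ext i
  by_cases h : i ∈ S <;> simp [extendCol, h]

lemma colNorm_add_le (hOm : IsNorm Om) (A B : Matrix {i // i ∈ S} κ ℝ) :
    colNorm Om (A + B) ≤ colNorm Om A + colNorm Om B := by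
  rw [colNorm, colNorm, colNorm, ← Finset.sum_add_distrib]
  refine Finset.sum_le_sum fun j _ => ?_
  refine le_of_eq_of_le ?_ (hOm.2.2 _ _)
  congr 1
  ext i
  by_cases h : i ∈ S <;> simp [extendCol, h]

/-- The pairing `A ↦ tr(Aᵀ Z)` as a linear functional. -/
def tracePairing {ι : Type*} [Fintype ι] (Z : Matrix ι κ ℝ) : Matrix ι κ ℝ →ₗ[ℝ] ℝ where
  toFun A := ∑ j, ∑ i, A i j * Z i j
  map_add' A B := by simp [add_mul, Finset.sum_add_distrib]
  map_smul' c A := by simp [mul_assoc, Finset.mul_sum]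

/-- Each column of `Z` is dominated, in the dual of `Om`, by the dual norm of `colNorm Om`. -/
lemma column_pairing_le (hOm : IsNorm Om) (Z : Matrix {i // i ∈ S} κ ℝ)
    (d : {i // i ∈ S} → ℝ) (k : κ) :
    ∑ i, Z i k * d i ≤ sSup (tracePairing Z '' {A | colNorm Om A ≤ 1}) *
      Om (fun i => if h : i ∈ S then d ⟨i, h⟩ else 0) := by
  classical
  let A : Matrix {i // i ∈ S} κ ℝ := fun i j => if j = k then d i else 0
  have hA : tracePairing Z A = ∑ i, Z i k * d i := by
    change ∑ j, ∑ i, (if j = k then d i else 0) * Z i j = _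
    rw [Finset.sum_eq_single k (fun j _ hj => by simp [hj]) (by simp)]
    simp [mul_comm]
  have hN : colNorm Om A = Om (fun i => if h : i ∈ S then d ⟨i, h⟩ else 0) := by
    rw [colNorm, Finset.sum_eq_single k _ (by simp)]
    · congr 1
      ext i
      simp [extendCol, A]
    · intro j _ hj
      rw [← norm_zero_of_smul hOm.2.1]
      congr 1
      ext i
      simp [extendCol, A, hj]
  rw [← hA, ← hN]
  exact linear_le_sSup_mul_norm (colNorm_eq_zero hOm) (colNorm_smul hOm) (colNorm_add_le hOm) _ A

lemma abs_column_pairing_le (hOm : IsNorm Om) (Z : Matrix {i // i ∈ S} κ ℝ)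
    (d : {i // i ∈ S} → ℝ) (k : κ) :
    |∑ i, Z i k * d i| ≤ sSup (tracePairing Z '' {A | colNorm Om A ≤ 1}) *
      Om (fun i => if h : i ∈ S then d ⟨i, h⟩ else 0) := by
  refine abs_le'.2 ⟨column_pairing_le hOm Z d k, ?_⟩
  have h := column_pairing_le hOm Z (-d) k
  have hneg : (fun i => if h : i ∈ S then (-d) ⟨i, h⟩ else 0) =
      -(fun i => if h : i ∈ S then d ⟨i, h⟩ else 0) := by
    ext i
    by_cases h : i ∈ S <;> simp [h]
  rw [hneg, norm_neg_of_smul hOm.2.1] at h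
  simpa using h

lemma WeaklyDecomposable.norm_compl_le (hOm : IsNorm Om) (hS : WeaklyDecomposable Om S)
    (v : Fin p → ℝ) : Om (fun i => if i ∈ Sᶜ then v i else 0) ≤ 2 * Om v := by
  obtain ⟨Om', -, hs, ha, hdec⟩ := hS
  have hnonneg : 0 ≤ Om' (fun i => if i ∈ S then 0 else v i) := by
    set w : Fin p → ℝ := fun i => if i ∈ S then 0 else v i with hw
    have hwS : ∀ i ∈ S, w i = 0 := fun i hi => by simp [hw, hi]
    have h0 := hs 0 w hwS
    have h1 := hs (-1) w hwS
    have h2 := ha w ((-1 : ℝ) • w) hwS (fun i hi => by simp [hwS i hi])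
    simp only [zero_smul, abs_zero, zero_mul] at h0
    simp only [neg_smul, one_smul, abs_neg, abs_one, one_mul, add_neg_cancel] at h1 h2
    linarith
  have hsplit : (fun i => if i ∈ Sᶜ then v i else 0) =
      v + -(fun i => if i ∈ S then v i else 0) := by
    ext i
    by_cases h : i ∈ S <;> simp [h]
  have h1 := hOm.2.2 v (-(fun i => if i ∈ S then v i else 0))
  rw [← hsplit, norm_neg_of_smul hOm.2.1] at h1
  linarith [hdec v]

end Extension

lemma mulVec_eq_add_compl {n p : ℕ} (X : Matrix (Fin n) (Fin p) ℝ) (J : Finset (Fin p))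
    (v : Fin p → ℝ) :
    X.mulVec v = (X.submatrix id (Subtype.val : {j // j ∈ J} → Fin p)).mulVec (fun j => v j) +
      (X.submatrix id (Subtype.val : {i // i ∈ Jᶜ} → Fin p)).mulVec (fun i => v i) := by
  ext a
  simp only [Matrix.mulVec, dotProduct, Pi.add_apply, Matrix.submatrix_apply, id]
  rw [Finset.sum_coe_sort J (fun i => X a i * v i), Finset.sum_coe_sort Jᶜ (fun i => X a i * v i),
    Finset.sum_add_sum_compl]

/-- Deterministic part of Theorem 2: decomposition of the normalized `|J|`-de-sparsified
`Ω` estimator and the `ℓ∞` bounds on the remainder term. -/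
theorem stmt8 {n p : ℕ} (hn : 0 < n)
    (X : Matrix (Fin n) (Fin p) ℝ) (Y ε : Fin n → ℝ) (β0 βh : Fin p → ℝ)
    (hmodel : Y = X.mulVec β0 + ε)
    (J : Finset (Fin p)) (lamJ : ℝ) (hlam : 0 < lamJ)
    (Om : (Fin p → ℝ) → ℝ) (hOm : IsNorm Om)
    (Ch : Matrix {i // i ∈ Jᶜ} {j // j ∈ J} ℝ)
    -- the submatrices `X_J`, `X_{Jᶜ}` and `X̃ = X_J − X_{Jᶜ}Ĉ`
    (XJ : Matrix (Fin n) {j // j ∈ J} ℝ) (hXJ : XJ = fun i j => X i j.val)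
    (XJc : Matrix (Fin n) {i // i ∈ Jᶜ} ℝ) (hXJc : XJc = fun i j => X i j.val)
    (Xt : Matrix (Fin n) {j // j ∈ J} ℝ) (hXt : Xt = XJ - XJc * Ch)
    -- `Σ̂_J = X̃ᵀX̃/n`, positive definite with positive definite inverse square root `R`
    (Sh : Matrix {j // j ∈ J} {j // j ∈ J} ℝ) (hSh : Sh = ((n : ℝ))⁻¹ • (Xtᵀ * Xt))
    (hShpd : Sh.PosDef)
    (R : Matrix {j // j ∈ J} {j // j ∈ J} ℝ) (hRpd : R.PosDef) (hRsq : R * Sh * R = 1)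
    -- `T_J = X̃ᵀX_J/n`, assumed invertible, and `M = √n · Σ̂_J^{−1/2} T_J`
    (TJ : Matrix {j // j ∈ J} {j // j ∈ J} ℝ) (hT : TJ = ((n : ℝ))⁻¹ • (Xtᵀ * XJ))
    (hTinv : IsUnit TJ.det)
    (M : Matrix {j // j ∈ J} {j // j ∈ J} ℝ) (hM : M = Real.sqrt n • (R * TJ))
    -- the `|J|`-de-sparsified estimator `b̂_J`
    (bh : {j // j ∈ J} → ℝ)
    (hb : bh = (fun j => βh j.val) +
      ((n : ℝ))⁻¹ • (TJ⁻¹ * Xtᵀ).mulVec (Y - X.mulVec βh))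
    -- the dual matrix norm `Ξ*` of `Ξ(A) = Σ_{j∈J} Ω(A_j)` (columns extended by zero)
    (Ξd : Matrix {i // i ∈ Jᶜ} {j // j ∈ J} ℝ → ℝ)
    (hΞd : Ξd = fun Z => sSup ((fun A => ∑ j, ∑ i, A i j * Z i j) ''
      {A : Matrix {i // i ∈ Jᶜ} {j // j ∈ J} ℝ |
        (∑ j : {j // j ∈ J},
          Om (fun i : Fin p => if h : i ∈ Jᶜ then A ⟨i, h⟩ j else 0)) ≤ 1}))
    -- dual feasibility condition
    (hfeas : Ξd (((n : ℝ))⁻¹ • (XJcᵀ * Xt * R)) ≤ lamJ)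
    -- the remainder term
    (rem : {j // j ∈ J} → ℝ)
    (hrem : rem = (Real.sqrt n)⁻¹ •
      (R * Xtᵀ * XJc).mulVec (fun i : {i // i ∈ Jᶜ} => β0 i.val - βh i.val)) :
    M.mulVec (fun j => bh j - β0 j.val) =
        (Real.sqrt n)⁻¹ • (R * Xtᵀ).mulVec ε + rem ∧
      (∀ j, |rem j| ≤ Real.sqrt n * lamJ *
        Om (fun i : Fin p => if i ∈ Jᶜ then βh i - β0 i else 0)) ∧
      (WeaklyDecomposable Om J →
        ∀ j, |rem j| ≤ 2 * Real.sqrt n * lamJ * Om (βh - β0)) := by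
  have hn' : (0 : ℝ) < n := Nat.cast_pos.2 hn
  have hsq : Real.sqrt n * Real.sqrt n = n := Real.mul_self_sqrt hn'.le
  have hs0 : Real.sqrt n ≠ 0 := (Real.sqrt_pos.2 hn').ne'
  have hinv : Real.sqrt n * (n : ℝ)⁻¹ = (Real.sqrt n)⁻¹ := by
    nth_rewrite 2 [← hsq]
    field_simp
  have hbound : ∀ j, |rem j| ≤ Real.sqrt n * lamJ *
      Om (fun i : Fin p => if i ∈ Jᶜ then βh i - β0 i else 0) := by
    intro j
    set Z := ((n : ℝ))⁻¹ • (XJcᵀ * Xt * R) with hZ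
    have hRt : Rᵀ = R := by simpa [Matrix.IsHermitian] using hRpd.isHermitian
    have hZt : R * Xtᵀ * XJc = (n : ℝ) • Zᵀ := by
      rw [hZ, Matrix.transpose_smul, smul_smul, mul_inv_cancel₀ hn'.ne', one_smul,
        Matrix.transpose_mul, Matrix.transpose_mul, Matrix.transpose_transpose, hRt,
        Matrix.mul_assoc]
    have hremj : rem j = -(Real.sqrt n * ∑ i, Z i j * (βh i.val - β0 i.val)) := by
      rw [hrem, hZt, Matrix.smul_mulVec, smul_smul]
      have hc : (Real.sqrt n)⁻¹ * n = Real.sqrt n := by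
        nth_rewrite 2 [← hsq]
        field_simp
      rw [hc, ← mul_neg, ← Finset.sum_neg_distrib]
      simp only [Pi.smul_apply, smul_eq_mul, Matrix.mulVec, dotProduct, Matrix.transpose_apply]
      congr 1
      refine Finset.sum_congr rfl fun i _ => ?_
      ring
    have hpair := abs_column_pairing_le hOm Z (fun i => βh i.val - β0 i.val) j
    have hdual : sSup (tracePairing Z '' {A | colNorm Om A ≤ 1}) ≤ lamJ := by
      rw [hΞd] at hfeas
      exact hfeas
    simp only [dite_eq_ite] at hpair
    rw [hremj, abs_neg, abs_mul, abs_of_nonneg (Real.sqrt_nonneg _), mul_assoc]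
    refine mul_le_mul_of_nonneg_left (hpair.trans ?_) (Real.sqrt_nonneg _)
    exact mul_le_mul_of_nonneg_right hdual (norm_nonneg_of_smul_of_add hOm.2.1 hOm.2.2 _)
  refine ⟨?_, hbound, fun hW j => (hbound j).trans ?_⟩
  · have hres : Y - X.mulVec βh = XJ.mulVec (fun j => β0 j.val - βh j.val) +
        XJc.mulVec (fun i => β0 i.val - βh i.val) + ε := by
      have h := mulVec_eq_add_compl X J (β0 - βh)
      rw [Matrix.mulVec_sub] at h
      have h' : Y - X.mulVec βh = (X.mulVec β0 - X.mulVec βh) + ε := by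
        rw [hmodel]
        abel
      rw [h', h, hXJ, hXJc]
      rfl
    have hdiff : (fun j => bh j - β0 j.val) = -(fun j : {j // j ∈ J} => β0 j.val - βh j.val) +
        ((n : ℝ))⁻¹ • (TJ⁻¹ * Xtᵀ).mulVec (Y - X.mulVec βh) := by
      rw [hb]
      ext j
      simp only [Pi.add_apply, Pi.neg_apply]
      ring
    have hMT : M * (TJ⁻¹ * Xtᵀ) = Real.sqrt n • (R * Xtᵀ) := by
      rw [hM, Matrix.smul_mul, Matrix.mul_assoc, ← Matrix.mul_assoc TJ,
        Matrix.mul_nonsing_inv _ hTinv, Matrix.one_mul]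
    have hMX : M = (Real.sqrt n)⁻¹ • (R * Xtᵀ * XJ) := by
      rw [hM, hT, Matrix.mul_smul, smul_smul, hinv, Matrix.mul_assoc]
    rw [hdiff, Matrix.mulVec_add, Matrix.mulVec_smul, Matrix.mulVec_mulVec, hMT,
      Matrix.smul_mulVec, smul_smul, mul_comm, hinv, hres, hMX, hrem, Matrix.mulVec_add,
      Matrix.mulVec_add, Matrix.mulVec_mulVec, Matrix.mulVec_mulVec, Matrix.mulVec_neg,
      Matrix.smul_mulVec, smul_add, smul_add]
    abel
  · have h := hW.norm_compl_le hOm (βh - β0)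
    simp only [Pi.sub_apply] at h
    have hc : 0 ≤ Real.sqrt n * lamJ := mul_nonneg (Real.sqrt_nonneg _) hlam.le
    calc _ ≤ Real.sqrt n * lamJ * (2 * Om (βh - β0)) := mul_le_mul_of_nonneg_left h hc
      _ = _ := by ring
end

section
/- Fix p ≥ 2 and 1 ≤ s ≤ p−1, and let S := {1,…,s}. Then for every β ∈ ℝ^p, the wedge norm of the vector β_{S^c} (equal to β on {s+1,…,p} and zero on S) satisfies ‖β_{S^c}‖_W ≤ √(s+1) · ‖(β_{s+1},…,β_p)‖_{W}, where the left-hand side is the wedge norm on ℝ^p and the right-hand side is the wedge norm on ℝ^{p−s}. -/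
open Finset

/-- The wedge norm on `ℝ^k`:
`‖v‖_W = inf { (1/2)·Σ_j (v_j²/a_j + a_j) : a₁ ≥ a₂ ≥ … ≥ a_k > 0 }`. -/
noncomputable def wedge (k : ℕ) (v : Fin k → ℝ) : ℝ :=
  sInf ((fun a : Fin k → ℝ => (1 / 2) * ∑ j, (v j ^ 2 / a j + a j)) ''
    {a | (∀ j, 0 < a j) ∧ ∀ j j' : Fin k, j ≤ j' → a j' ≤ a j})

/-- Every admissible weight bounds the wedge norm from above. -/
lemma wedge_le {k : ℕ} (v a : Fin k → ℝ) (ha : ∀ j, 0 < a j)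
    (hanti : ∀ j j' : Fin k, j ≤ j' → a j' ≤ a j) :
    wedge k v ≤ (1 / 2) * ∑ j, (v j ^ 2 / a j + a j) := by
  refine csInf_le ⟨0, ?_⟩ ⟨a, ⟨ha, hanti⟩, rfl⟩
  rintro _ ⟨b, ⟨hb, -⟩, rfl⟩
  have : 0 ≤ ∑ j, (v j ^ 2 / b j + b j) :=
    Finset.sum_nonneg fun j _ => by have := hb j; positivity
  positivity

/-- A bound by every admissible value is a bound by the wedge norm. -/
lemma le_wedge {k : ℕ} {v : Fin k → ℝ} {c : ℝ}
    (h : ∀ a : Fin k → ℝ, (∀ j, 0 < a j) → (∀ j j' : Fin k, j ≤ j' → a j' ≤ a j) →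
      c ≤ (1 / 2) * ∑ j, (v j ^ 2 / a j + a j)) :
    c ≤ wedge k v := by
  refine le_csInf ⟨_, fun _ => 1, ⟨fun _ => one_pos, fun _ _ _ => le_rfl⟩, rfl⟩ ?_
  rintro _ ⟨a, ⟨ha, hanti⟩, rfl⟩
  exact h a ha hanti

/-- Prepending `s` zeros multiplies the wedge norm by at most `√(s+1)`. -/
lemma wedge_zero_prepend_le (s m : ℕ) (hm : 0 < m) (β : Fin (s + m) → ℝ) :
    wedge (s + m) (fun i => if s ≤ (i : ℕ) then β i else 0) ≤
      Real.sqrt (s + 1) * wedge m (fun i => β (Fin.natAdd s i)) := by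
  have hc : 0 < Real.sqrt (s + 1) := Real.sqrt_pos.2 (by positivity)
  have hc2 : Real.sqrt (s + 1) ^ 2 = s + 1 := Real.sq_sqrt (by positivity)
  generalize Real.sqrt (s + 1) = c at hc hc2 ⊢
  rw [← div_le_iff₀' hc]
  refine le_wedge fun a ha hanti => ?_
  rw [div_le_iff₀' hc]
  let b : Fin (s + m) → ℝ := fun i => a ⟨i - s, by omega⟩ / c
  refine (wedge_le _ b (fun j => div_pos (ha _) hc) fun j j' hjj' =>
    div_le_div_of_nonneg_right (hanti _ _ (Nat.sub_le_sub_right hjj' s)) hc.le).trans ?_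
  have hfst (i : Fin s) : b (Fin.castAdd m i) = a ⟨0, hm⟩ / c := by
    simp [b, Nat.sub_eq_zero_of_le i.isLt.le]
  have hsnd (i : Fin m) : b (Fin.natAdd s i) = a i / c := by simp [b]
  have hle : a ⟨0, hm⟩ ≤ ∑ j, a j :=
    Finset.single_le_sum (fun j _ => (ha j).le) (Finset.mem_univ _)
  have hsum : s * (a ⟨0, hm⟩ / c) + (∑ j, a j) / c ≤ c * ∑ j, a j := by
    rw [← mul_div_assoc, ← add_div, div_le_iff₀ hc]
    have : (s : ℝ) * a ⟨0, hm⟩ ≤ s * ∑ j, a j := by gcongr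
    linear_combination this - (∑ j, a j) * hc2
  have hquad : ∑ j, β (Fin.natAdd s j) ^ 2 / (a j / c) =
      c * ∑ j, β (Fin.natAdd s j) ^ 2 / a j := by
    rw [Finset.mul_sum]
    exact Finset.sum_congr rfl fun j _ => by rw [div_div_eq_mul_div]; ring
  rw [Fin.sum_univ_add]
  simp only [hfst, hsnd, Fin.val_castAdd, Fin.val_natAdd, Nat.le_add_right, if_true,
    fun i : Fin s => not_le.2 i.isLt, if_false, Finset.sum_add_distrib, Finset.sum_const,
    Finset.card_univ, Fintype.card_fin, nsmul_eq_mul, hquad, ← Finset.sum_div]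
  norm_num
  linarith

/-- For `S = {1,…,s}`, the wedge norm of `β_{Sᶜ}` (on `ℝ^p`) is bounded by
`√(s+1)` times the wedge norm of `(β_{s+1},…,β_p)` (on `ℝ^{p−s}`). -/
theorem stmt12 {p s : ℕ} (hp : 2 ≤ p) (hs1 : 1 ≤ s) (hs2 : s ≤ p - 1) (β : Fin p → ℝ) :
    wedge p (fun i => if s ≤ (i : ℕ) then β i else 0) ≤
      Real.sqrt (s + 1) *
        wedge (p - s) (fun i => β ⟨s + (i : ℕ), by have := i.isLt; omega⟩) := by
  obtain ⟨m, rfl⟩ : ∃ m, p = s + m := ⟨p - s, by omega⟩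
  have hcast : ∀ k (hk : k = m),
      wedge k (fun i => β ⟨s + (i : ℕ), by have := i.isLt; omega⟩) =
        wedge m (fun i => β (Fin.natAdd s i)) := by
    rintro _ rfl
    rfl
  rw [hcast _ (Nat.add_sub_cancel_left s m)]
  exact wedge_zero_prepend_le s m (by omega) β
end

section
/- Fix p ≥ 2 and let the Lorentz norm on ℝ^p be ‖β‖_Lo := inf{ (1/2)·Σ_{i=1}^p (β_i²/a_i + a_i) : a ∈ ℝ^p, a_i > 0 for all i, a_p ≥ √(Σ_{i=1}^{p−1} a_i²) } (with 0/0 := 0). Then for every β ∈ ℝ^p with β_p = 0 one has ‖β‖_Lo ≤ ‖β‖₁ + (1/2)‖β‖₂ ≤ (3/2)‖β‖₁. -/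
open Finset

/-- The Euclidean norm of a shifted vector of absolute values grows at most linearly in the
shift. -/
lemma sqrt_sum_abs_add_sq_le {ι : Type*} [Fintype ι] (s : Finset ι) (β : ι → ℝ) {ε : ℝ}
    (hε : 0 ≤ ε) :
    Real.sqrt (∑ i ∈ s, (|β i| + ε) ^ 2) ≤
      Real.sqrt (∑ i, β i ^ 2) + Fintype.card ι * ε := by
  set S := Real.sqrt (∑ i, β i ^ 2) with hS
  have hS0 : 0 ≤ S := Real.sqrt_nonneg _
  have hsq : S ^ 2 = ∑ i, β i ^ 2 := Real.sq_sqrt (sum_nonneg fun i _ => sq_nonneg _)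
  have habs (i : ι) : |β i| ≤ S :=
    Real.abs_le_sqrt (single_le_sum (f := fun i => β i ^ 2) (fun i _ => sq_nonneg _) (mem_univ i))
  have hcard : (Fintype.card ι : ℝ) ≤ (Fintype.card ι : ℝ) ^ 2 := by
    exact_mod_cast Nat.le_self_pow two_ne_zero _
  refine Real.sqrt_le_iff.2 ⟨by positivity, ?_⟩
  calc ∑ i ∈ s, (|β i| + ε) ^ 2
      ≤ ∑ i, (|β i| + ε) ^ 2 :=
        sum_le_sum_of_subset_of_nonneg (subset_univ s) fun i _ _ => sq_nonneg _
    _ ≤ ∑ i, (β i ^ 2 + (2 * S * ε + ε ^ 2)) := by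
        refine sum_le_sum fun i _ => ?_
        have := mul_le_mul_of_nonneg_right (habs i) hε
        nlinarith [sq_abs (β i)]
    _ = S ^ 2 + Fintype.card ι * (2 * S * ε + ε ^ 2) := by
        rw [sum_add_distrib, hsq, sum_const, card_univ, nsmul_eq_mul]
    _ ≤ (S + Fintype.card ι * ε) ^ 2 := by
        nlinarith [mul_le_mul_of_nonneg_right hcard (sq_nonneg ε)]

/-- The Euclidean norm is at most the `ℓ₁`-norm. -/
lemma sqrt_sum_sq_le_sum_abs {ι : Type*} [Fintype ι] (β : ι → ℝ) :
    Real.sqrt (∑ i, β i ^ 2) ≤ ∑ i, |β i| := by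
  refine Real.sqrt_le_iff.2 ⟨sum_nonneg fun i _ => abs_nonneg _, ?_⟩
  simpa only [sq_abs] using sum_sq_le_sq_sum_of_nonneg (s := univ)
    (f := fun i => |β i|) fun i _ => abs_nonneg _

/-- For the Lorentz norm
`‖β‖_Lo = inf {(1/2)·Σ_i (β_i²/a_i + a_i) : a ∈ (0,∞)^p, a_p ≥ √(Σ_{i<p} a_i²)}`
and any `β` with `β_p = 0`, one has `‖β‖_Lo ≤ ‖β‖₁ + (1/2)‖β‖₂ ≤ (3/2)‖β‖₁`. -/
theorem stmt16 {p : ℕ} (hp : 2 ≤ p) (Lo : (Fin p → ℝ) → ℝ)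
    (hLo : Lo = fun β => sInf
      ((fun a : Fin p → ℝ => (1 / 2) * ∑ i, (β i ^ 2 / a i + a i)) ''
        {a | (∀ i, 0 < a i) ∧
          Real.sqrt (∑ i ∈ Finset.univ.filter (fun i : Fin p => (i : ℕ) < p - 1), a i ^ 2) ≤
            a ⟨p - 1, by omega⟩}))
    (β : Fin p → ℝ) (hβ : β ⟨p - 1, by omega⟩ = 0) :
    Lo β ≤ ∑ i, |β i| + (1 / 2) * Real.sqrt (∑ i, β i ^ 2) ∧
      ∑ i, |β i| + (1 / 2) * Real.sqrt (∑ i, β i ^ 2) ≤ (3 / 2) * ∑ i, |β i| := by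
  refine ⟨?_, by linarith [sqrt_sum_sq_le_sum_abs β]⟩
  subst hLo
  have hp0 : (0 : ℝ) < p := by exact_mod_cast (by omega : 0 < p)
  refine le_of_forall_pos_le_add fun δ hδ => ?_
  set ε := δ / p with hε
  have hε0 : 0 < ε := by positivity
  have hpε : p * ε = δ := by rw [hε]; field_simp
  set S := Real.sqrt (∑ i, β i ^ 2) with hS
  have hS0 : 0 ≤ S := Real.sqrt_nonneg _
  set l : Fin p := ⟨p - 1, by omega⟩ with hl
  set a : Fin p → ℝ := fun i => if i = l then S + p * ε else |β i| + ε with ha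
  have ha0 (i : Fin p) : 0 < a i := by
    simp only [ha]
    split_ifs <;> positivity
  beta_reduce
  refine csInf_le_of_le ?_ ⟨a, ?_, rfl⟩ ?_
  · refine ⟨0, ?_⟩
    rintro _ ⟨b, ⟨hb, -⟩, rfl⟩
    have : 0 ≤ ∑ i, (β i ^ 2 / b i + b i) :=
      sum_nonneg fun i _ => add_nonneg (div_nonneg (sq_nonneg _) (hb i).le) (hb i).le
    simpa using this
  · refine ⟨ha0, ?_⟩
    have hal : a l = S + p * ε := if_pos rfl
    rw [hal]
    have h := sqrt_sum_abs_add_sq_le (univ.filter fun i : Fin p => (i : ℕ) < p - 1) β hε0.le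
    rw [Fintype.card_fin] at h
    refine (le_of_eq ?_).trans h
    congr 1
    refine sum_congr rfl fun i hi => ?_
    have hil : i ≠ l := fun h => by
      have := (mem_filter.1 hi).2
      rw [h] at this
      exact lt_irrefl _ this
    rw [show a i = |β i| + ε from if_neg hil]
  · have hterm (i : Fin p) :
        β i ^ 2 / a i + a i ≤ 2 * |β i| + ε + if i = l then S + p * ε else 0 := by
      by_cases hil : i = l
      · subst hil
        simp only [ha, hβ, if_true, abs_zero]
        norm_num
        exact hε0.le
      · have hai : a i = |β i| + ε := if_neg hil
        have : β i ^ 2 / a i ≤ |β i| := by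
          rw [div_le_iff₀ (ha0 i), hai]
          nlinarith [sq_abs (β i), mul_nonneg (abs_nonneg (β i)) hε0.le]
        rw [if_neg hil]
        linarith
    have hsum := sum_le_sum fun i (_ : i ∈ univ) => hterm i
    simp only [sum_add_distrib, ← mul_sum, sum_ite_eq', mem_univ, if_true, sum_const, card_univ,
      Fintype.card_fin, nsmul_eq_mul] at hsum
    simp only [sum_add_distrib]
    linarith
end

section
/- Let 1 ≥ l₁ ≥ l₂ ≥ … ≥ l_p > 0 be a nonincreasing positive sequence and define the SLOPE norm J_l(β) := max over permutations σ of {1,…,p} of Σ_{i=1}^p l_i·|β_{σ(i)}|. For S ⊆ {1,…,p} with |S| = s, define Υ_S(β) := (max over bijections ρ : S → {1,…,s} of Σ_{j∈S} l_{ρ(j)}|β_j|) + (max over bijections τ : S^c → {s+1,…,p} of Σ_{j∈S^c} l_{τ(j)}|β_j|). If g is a norm on ℝ^p such that l_p·‖β‖₁ ≤ g(β) ≤ Υ_S(β) for every β ∈ ℝ^p and every subset S ⊆ {1,…,p}, then g(β) = l_p·‖β‖₁ for all β ∈ ℝ^p. -/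
open Finset

/-- A norm is bounded by the sum of its values on the coordinate components. -/
theorem IsNorm.le_sum_single {p : ℕ} {g : (Fin p → ℝ) → ℝ} (hg : IsNorm g) (β : Fin p → ℝ) :
    g β ≤ ∑ i, g (Pi.single i (β i)) := by
  have h0 : g 0 = 0 := by simpa using hg.2.1 0 0
  conv_lhs => rw [← Finset.univ_sum_single β]
  exact Finset.le_sum_of_subadditive g h0.le hg.2.2 _ _

/-- For the SLOPE weights `1 ≥ l₁ ≥ … ≥ l_p > 0` and
`Υ_S(β) = (max_ρ Σ_{j∈S} l_{ρ(j)}|β_j|) + (max_τ Σ_{j∈Sᶜ} l_{τ(j)}|β_j|)`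
(`ρ : S → {1,…,s}`, `τ : Sᶜ → {s+1,…,p}` bijections), any norm `g` with
`l_p·‖β‖₁ ≤ g(β) ≤ Υ_S(β)` for every `β` and every `S` equals `l_p·‖·‖₁`. -/
theorem stmt18 {p : ℕ} (hp : 0 < p) (l : Fin p → ℝ)
    (hl1 : ∀ i, l i ≤ 1) (hlpos : ∀ i, 0 < l i)
    (hmono : ∀ i j : Fin p, i ≤ j → l j ≤ l i)
    (g : (Fin p → ℝ) → ℝ) (hg : IsNorm g)
    (hlow : ∀ β : Fin p → ℝ, l ⟨p - 1, by omega⟩ * ∑ i, |β i| ≤ g β)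
    (hup : ∀ (S : Finset (Fin p)) (β : Fin p → ℝ),
      g β ≤
        (⨆ ρ : {j // j ∈ S} ≃ Fin S.card,
          ∑ j : {j // j ∈ S},
            l ⟨((ρ j : Fin S.card) : ℕ), by
              have h1 := (ρ j).isLt
              have h2 : S.card ≤ p := by
                simpa using Finset.card_le_univ S
              omega⟩ * |β j.val|) +
        ⨆ τ : {j // j ∈ Sᶜ} ≃ Fin (Sᶜ.card),
          ∑ j : {j // j ∈ Sᶜ},
            l ⟨S.card + ((τ j : Fin (Sᶜ.card)) : ℕ), by
              have h1 := (τ j).isLt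
              simp [Finset.card_compl, Fintype.card_fin] at h1
              have h2 : S.card ≤ p := by
                simpa using Finset.card_le_univ S
              omega⟩ * |β j.val|) :
    ∀ β : Fin p → ℝ, g β = l ⟨p - 1, by omega⟩ * ∑ i, |β i| := by
  intro β
  refine le_antisymm ((hg.le_sum_single β).trans ?_) (hlow β)
  rw [Finset.mul_sum]
  refine Finset.sum_le_sum fun i _ => (hup {i}ᶜ (Pi.single i (β i))).trans ?_
  have hL := (hlpos ⟨p - 1, by omega⟩).le
  refine (add_le_add (Real.iSup_le (a := 0) (fun ρ => ?_) le_rfl)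
    (Real.iSup_le (fun τ => ?_) (mul_nonneg hL (abs_nonneg (β i))))).trans (zero_add _).le
  · refine (Finset.sum_eq_zero fun j _ => ?_).le
    have hj : j.val ≠ i := Finset.notMem_singleton.mp (Finset.mem_compl.mp j.2)
    simp [hj]
  · calc
      _ = ∑ j : {j // j ∈ (({i}ᶜ : Finset (Fin p))ᶜ)},
          l ⟨p - 1, by omega⟩ * |(Pi.single i (β i) : Fin p → ℝ) j.val| := by
        refine Finset.sum_congr rfl fun j _ => ?_
        congr 2
        have hτ := (τ j).isLt
        simp only [compl_compl, Finset.card_singleton] at hτ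
        simp only [Fin.mk.injEq, Finset.card_compl, Fintype.card_fin, Finset.card_singleton]
        omega
      _ = ∑ j ∈ (({i}ᶜ : Finset (Fin p))ᶜ),
          l ⟨p - 1, by omega⟩ * |(Pi.single i (β i) : Fin p → ℝ) j| :=
        Finset.sum_coe_sort _
          fun j => l ⟨p - 1, by omega⟩ * |(Pi.single i (β i) : Fin p → ℝ) j|
      _ ≤ _ := by simp
end
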